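/- Let q be a prime power, 1 ≤ d ≤ r, and let 𝒞 be a set of at least two m×n matrices over GF(q), all of rank r, whose minimum rank distance equals d + r. Then |R(𝒞)| = |C(𝒞)| = |𝒞|, and the minimum injection distances satisfy d_I(C(𝒞)) + d_I(R(𝒞)) ≤ d + r ≤ min{d_I(C(𝒞)), d_I(R(𝒞))} + r. -/

import Mathlib

open Module

noncomputable def injDist {F V : Type*} [Field F] [AddCommGroup V] [Module F V]
    (U W : Submodule F V) : ℕ :=
  finrank F ↥(U ⊔ W) - min (finrank F ↥U) (finrank F ↥W)

def rowSpace {F : Type*} [CommRing F] {m n : ℕ} (X : Matrix (Fin m) (Fin n) F) :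
    Submodule F (Fin n → F) :=
  LinearMap.range X.vecMulLinear

def colSpace {F : Type*} [CommRing F] {m n : ℕ} (X : Matrix (Fin m) (Fin n) F) :
    Submodule F (Fin m → F) :=
  LinearMap.range X.mulVecLin

noncomputable def minRankDist {F : Type*} [Field F] {m n : ℕ}
    (C : Set (Matrix (Fin m) (Fin n) F)) : ℕ :=
  sInf {e | ∃ X ∈ C, ∃ Y ∈ C, X ≠ Y ∧ (X - Y).rank = e}

noncomputable def minInjDist {F V : Type*} [Field F] [AddCommGroup V] [Module F V]
    (S : Set (Submodule F V)) : ℕ :=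
  sInf {e | ∃ U ∈ S, ∃ W ∈ S, U ≠ W ∧ injDist U W = e}

/-- Maximum cardinality of a nonempty code of `m × n` matrices whose ranks all lie in `I`
and in which any two distinct codewords are at rank distance at least `d`. -/
noncomputable def maxRankCode (F : Type*) [Field F] [Fintype F] (m n d : ℕ) (I : Set ℕ) : ℕ :=
  sSup {c : ℕ | ∃ C : Set (Matrix (Fin m) (Fin n) F), C.Nonempty ∧
    (∀ X ∈ C, X.rank ∈ I) ∧
    (∀ X ∈ C, ∀ Y ∈ C, X ≠ Y → d ≤ (X - Y).rank) ∧ C.ncard = c}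

/-- `A_R(q,m,n,d,r)` : maximum cardinality of a constant-rank code of constant rank `r`
and minimum rank distance at least `d` in `GF(q)^{m × n}`. -/
noncomputable def A_R (F : Type*) [Field F] [Fintype F] (m n d r : ℕ) : ℕ :=
  maxRankCode F m n d {r}

/-- `A_C(q,n,r,d)` : maximum cardinality of a constant-dimension code of dimension `r`
and minimum injection distance at least `d` in `GF(q)^n`. -/
noncomputable def A_C (F : Type*) [Field F] [Fintype F] (n r d : ℕ) : ℕ :=
  sSup {c : ℕ | ∃ S : Set (Submodule F (Fin n → F)), S.Nonempty ∧
    (∀ U ∈ S, finrank F ↥U = r) ∧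
    (∀ U ∈ S, ∀ V ∈ S, U ≠ V → d ≤ injDist U V) ∧ S.ncard = c}

/-- `N_R(q,m,n,r)` : number of `m × n` matrices over `GF(q)` of rank `r`. -/
noncomputable def N_R (F : Type*) [Field F] [Fintype F] (m n r : ℕ) : ℕ :=
  Nat.card {X : Matrix (Fin m) (Fin n) F // X.rank = r}

/-- `α(m,s) = ∏_{i=0}^{s-1} (q^m - q^i)`. -/
def alphaq (q m s : ℕ) : ℕ := ∏ i ∈ Finset.range s, (q ^ m - q ^ i)

/-- The Gaussian binomial `[n r]_q = α(n,r) / α(r,r)`. -/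
def gaussBinom (q n r : ℕ) : ℕ := alphaq q n r / alphaq q r r

/-- `K_q = ∏_{j=1}^∞ (1 - q^{-j})`. -/
noncomputable def Kq (q : ℕ) : ℝ := ∏' j : ℕ, (1 - ((q : ℝ))⁻¹ ^ (j + 1))

/-- `M(q,m,n,d,r)` : the number of codewords of rank `r` in an `(n, n-d+1, d)` linear MRD
code over `GF(q^m)`. -/
def Mcount (q m n d r : ℕ) : ℤ :=
  (gaussBinom q n r : ℤ) *
    ∑ j ∈ Finset.Icc d r, (-1 : ℤ) ^ (r - j) * (gaussBinom q r j : ℤ) *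
      (q : ℤ) ^ ((r - j) * (r - j - 1) / 2) * ((q : ℤ) ^ (m * (j - d + 1)) - 1)

theorem rowSpace_eq_aux {F : Type*} [Field F] {m n : ℕ} (X : Matrix (Fin m) (Fin n) F) :
    rowSpace X = colSpace X.transpose := by
  ext v
  simp only [rowSpace, colSpace, LinearMap.mem_range, Matrix.mulVecLin_apply,
    Matrix.vecMulLinear_apply, Matrix.mulVec_transpose]

theorem finrank_colSpace_aux {F : Type*} [Field F] {m n : ℕ} (X : Matrix (Fin m) (Fin n) F) :
    finrank F (colSpace X) = X.rank := rfl

theorem finrank_rowSpace_aux {F : Type*} [Field F] {m n : ℕ} (X : Matrix (Fin m) (Fin n) F) :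
    finrank F (rowSpace X) = X.rank := by
  rw [rowSpace_eq_aux, finrank_colSpace_aux, Matrix.rank_transpose]

theorem rank_sub_le_col {F : Type*} [Field F] {m n : ℕ} (X Y : Matrix (Fin m) (Fin n) F) :
    (X - Y).rank ≤ finrank F ↥(colSpace X ⊔ colSpace Y) := by
  rw [← finrank_colSpace_aux]
  apply Submodule.finrank_mono
  rintro _ ⟨v, rfl⟩
  rw [Matrix.mulVecLin_apply, Matrix.sub_mulVec]
  exact Submodule.sub_mem _ (Submodule.mem_sup_left ⟨v, rfl⟩) (Submodule.mem_sup_right ⟨v, rfl⟩)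

theorem rank_sub_le_row {F : Type*} [Field F] {m n : ℕ} (X Y : Matrix (Fin m) (Fin n) F) :
    (X - Y).rank ≤ finrank F ↥(rowSpace X ⊔ rowSpace Y) := by
  rw [rowSpace_eq_aux, rowSpace_eq_aux, ← Matrix.rank_transpose, Matrix.transpose_sub]
  exact rank_sub_le_col _ _

theorem ker_inf_aux {F : Type*} [Field F] {m n : ℕ} (X Y : Matrix (Fin m) (Fin n) F) :
    finrank F ↥(LinearMap.ker X.mulVecLin ⊓ LinearMap.ker Y.mulVecLin) +
      finrank F ↥(rowSpace X ⊔ rowSpace Y) ≤ n := by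
  have hk : LinearMap.ker (Matrix.fromRows X Y).mulVecLin =
      LinearMap.ker X.mulVecLin ⊓ LinearMap.ker Y.mulVecLin := by
    ext v
    simp only [LinearMap.mem_ker, Submodule.mem_inf, Matrix.mulVecLin_apply,
      Matrix.fromRows_mulVec]
    constructor
    · intro h
      exact ⟨funext fun i => congrFun h (Sum.inl i), funext fun i => congrFun h (Sum.inr i)⟩
    · rintro ⟨h1, h2⟩
      rw [h1, h2]; ext (i | i) <;> rfl
  have hr : rowSpace X ⊔ rowSpace Y ≤
      LinearMap.range (Matrix.fromRows X Y).transpose.mulVecLin := by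
    refine sup_le ?_ ?_
    · rintro _ ⟨v, rfl⟩
      refine ⟨Sum.elim v 0, ?_⟩
      simp [Matrix.mulVec_transpose, Matrix.vecMul_fromRows]
    · rintro _ ⟨v, rfl⟩
      refine ⟨Sum.elim 0 v, ?_⟩
      simp [Matrix.mulVec_transpose, Matrix.vecMul_fromRows]
  have h1 := Submodule.finrank_mono hr
  have h2 : finrank F (LinearMap.range (Matrix.fromRows X Y).transpose.mulVecLin) =
      finrank F (LinearMap.range (Matrix.fromRows X Y).mulVecLin) :=
    Matrix.rank_transpose (Matrix.fromRows X Y)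
  have h3 := LinearMap.finrank_range_add_finrank_ker (Matrix.fromRows X Y).mulVecLin
  rw [hk, Module.finrank_fin_fun] at h3
  omega

theorem row_sup_le {F : Type*} [Field F] {m n : ℕ} (X Y : Matrix (Fin m) (Fin n) F) :
    finrank F ↥(rowSpace X ⊔ rowSpace Y) ≤
      (X - Y).rank + finrank F ↥(colSpace X ⊓ colSpace Y) := by
  have h0 := ker_inf_aux X Y
  have h3 := LinearMap.finrank_range_add_finrank_ker (X - Y).mulVecLin
  rw [Module.finrank_fin_fun] at h3
  have h4 : finrank F (LinearMap.range (X - Y).mulVecLin) = (X - Y).rank := rfl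
  let g := X.mulVecLin.domRestrict (LinearMap.ker (X - Y).mulVecLin)
  have h5 := LinearMap.finrank_range_add_finrank_ker g
  have h6 : finrank F (LinearMap.range g) ≤ finrank F ↥(colSpace X ⊓ colSpace Y) := by
    apply Submodule.finrank_mono
    rintro _ ⟨⟨v, hv⟩, rfl⟩
    refine ⟨⟨v, rfl⟩, ⟨v, ?_⟩⟩
    rw [LinearMap.mem_ker, Matrix.mulVecLin_apply, Matrix.sub_mulVec, sub_eq_zero] at hv
    exact hv.symm
  have h7 : finrank F (LinearMap.ker g) ≤
      finrank F ↥(LinearMap.ker X.mulVecLin ⊓ LinearMap.ker Y.mulVecLin) := by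
    rw [← Submodule.finrank_map_subtype_eq]
    apply Submodule.finrank_mono
    rintro _ ⟨⟨v, hv⟩, hg, rfl⟩
    have hx : X.mulVec v = 0 := hg
    rw [LinearMap.mem_ker, Matrix.mulVecLin_apply, Matrix.sub_mulVec, sub_eq_zero] at hv
    exact ⟨hx, hv.symm.trans hx⟩
  omega

theorem stmt2 {q m n d r : ℕ} (F : Type*) [Field F] [Fintype F] (hF : Fintype.card F = q)
    (hd1 : 1 ≤ d) (hdr : d ≤ r)
    (C : Set (Matrix (Fin m) (Fin n) F))
    (htwo : ∃ X ∈ C, ∃ Y ∈ C, X ≠ Y)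
    (hrk : ∀ X ∈ C, X.rank = r)
    (hmin : minRankDist C = d + r) :
    (rowSpace '' C).ncard = C.ncard ∧ (colSpace '' C).ncard = C.ncard ∧
      minInjDist (colSpace '' C) + minInjDist (rowSpace '' C) ≤ d + r ∧
      d + r ≤ min (minInjDist (colSpace '' C)) (minInjDist (rowSpace '' C)) + r := by
  have hlow : ∀ X ∈ C, ∀ Y ∈ C, X ≠ Y → d + r ≤ (X - Y).rank := by
    intro X hX Y hY hne
    rw [← hmin]
    exact Nat.sInf_le ⟨X, hX, Y, hY, hne, rfl⟩
  have hcol : ∀ X ∈ C, ∀ Y ∈ C, X ≠ Y → d ≤ injDist (colSpace X) (colSpace Y) := by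
    intro X hX Y hY hne
    have h1 := hlow X hX Y hY hne
    have h2 := rank_sub_le_col X Y
    unfold injDist
    rw [finrank_colSpace_aux, finrank_colSpace_aux, hrk X hX, hrk Y hY]
    omega
  have hrow : ∀ X ∈ C, ∀ Y ∈ C, X ≠ Y → d ≤ injDist (rowSpace X) (rowSpace Y) := by
    intro X hX Y hY hne
    have h1 := hlow X hX Y hY hne
    have h2 := rank_sub_le_row X Y
    unfold injDist
    rw [finrank_rowSpace_aux, finrank_rowSpace_aux, hrk X hX, hrk Y hY]
    omega
  have hci : Set.InjOn colSpace C := by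
    intro X hX Y hY h
    by_contra hne
    have := hcol X hX Y hY hne
    rw [h] at this
    rw [injDist, sup_idem, min_self] at this
    omega
  have hri : Set.InjOn rowSpace C := by
    intro X hX Y hY h
    by_contra hne
    have := hrow X hX Y hY hne
    rw [h] at this
    rw [injDist, sup_idem, min_self] at this
    omega
  refine ⟨hri.ncard_image, hci.ncard_image, ?_, ?_⟩
  · obtain ⟨X, hX, Y, hY, hne, he⟩ : d + r ∈
        {e | ∃ X ∈ C, ∃ Y ∈ C, X ≠ Y ∧ (X - Y).rank = e} := by
      rw [← hmin]
      obtain ⟨X, hX, Y, hY, hne⟩ := htwo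
      exact Nat.sInf_mem ⟨_, X, hX, Y, hY, hne, rfl⟩
    have h1 : minInjDist (colSpace '' C) ≤ injDist (colSpace X) (colSpace Y) :=
      Nat.sInf_le ⟨_, ⟨X, hX, rfl⟩, _, ⟨Y, hY, rfl⟩, fun h => hne (hci hX hY h), rfl⟩
    have h2 : minInjDist (rowSpace '' C) ≤ injDist (rowSpace X) (rowSpace Y) :=
      Nat.sInf_le ⟨_, ⟨X, hX, rfl⟩, _, ⟨Y, hY, rfl⟩, fun h => hne (hri hX hY h), rfl⟩
    have h3 := row_sup_le X Y
    have h4 := Submodule.finrank_sup_add_finrank_inf_eq (colSpace X) (colSpace Y)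
    unfold injDist at h1 h2
    rw [finrank_rowSpace_aux, finrank_rowSpace_aux, hrk X hX, hrk Y hY] at h2
    rw [finrank_colSpace_aux, finrank_colSpace_aux, hrk X hX, hrk Y hY] at h1 h4
    have h6 : finrank F (colSpace X) ≤ finrank F ↥(colSpace X ⊔ colSpace Y) :=
      Submodule.finrank_mono le_sup_left
    have h7 : finrank F (rowSpace X) ≤ finrank F ↥(rowSpace X ⊔ rowSpace Y) :=
      Submodule.finrank_mono le_sup_left
    rw [finrank_colSpace_aux, hrk X hX] at h6
    rw [finrank_rowSpace_aux, hrk X hX] at h7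
    omega
  · obtain ⟨X, hX, Y, hY, hne⟩ := htwo
    have h1 : d ≤ minInjDist (colSpace '' C) := by
      refine le_csInf ⟨_, _, ⟨X, hX, rfl⟩, _, ⟨Y, hY, rfl⟩,
        fun h => hne (hci hX hY h), rfl⟩ ?_
      rintro _ ⟨_, ⟨A, hA, rfl⟩, _, ⟨B, hB, rfl⟩, hAB, rfl⟩
      exact hcol A hA B hB fun h => hAB (by rw [h])
    have h2 : d ≤ minInjDist (rowSpace '' C) := by
      refine le_csInf ⟨_, _, ⟨X, hX, rfl⟩, _, ⟨Y, hY, rfl⟩,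
        fun h => hne (hri hX hY h), rfl⟩ ?_
      rintro _ ⟨_, ⟨A, hA, rfl⟩, _, ⟨B, hB, rfl⟩, hAB, rfl⟩
      exact hrow A hA B hB fun h => hAB (by rw [h])
    have := le_min h1 h2
    omega
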